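/- arXiv:0912.5438 — 2 statements merged into one kernel-verified Lean document; each statement's English description precedes it below -/
import Mathlib

section
/- Partial duality is an involution: for any ribbon graph with flags G = (σ₀, θ, σ₁) and any subset E' ⊆ E(G), taking the partial dual with respect to E' twice returns G, i.e. (G^{E'})^{E'} = G as triples of permutations (using the canonical identification of the edges of G^{E'} with those of G). -/
set_option linter.unusedSectionVars false

open Finset

namespace RibbonPaper

variable {X : Type} [Fintype X] [DecidableEq X]

/-- Raw combinatorial data of a ribbon graph with flags: three permutations of
the finite set of crosses. -/
structure RawRibbon (X : Type) [Fintype X] [DecidableEq X] where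
  s0 : Equiv.Perm X
  th : Equiv.Perm X
  s1 : Equiv.Perm X

namespace RawRibbon

/-- The axioms of a combinatorial map with flags (ribbon graph with flags). -/
def IsRibbon (G : RawRibbon X) : Prop :=
  G.th ^ 2 = 1 ∧ G.s1 ^ 2 = 1 ∧ G.th * G.s1 = G.s1 * G.th ∧
    (∀ x, G.th x ≠ x) ∧ (∀ x, G.th x ≠ G.s1 x) ∧
    G.s0 * G.th = G.th * G.s0⁻¹ ∧
    ∀ (x : X) (n : ℤ), (G.s0 ^ n) x ≠ G.th x

/-- A ribbon graph without flags: `σ₁` is fixed-point free. -/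
def NoFlags (G : RawRibbon X) : Prop := ∀ x, G.s1 x ≠ x

/-- The edges: 4-element orbits `{x, θx, σ₁x, σ₁θx}` of crosses not fixed by `σ₁`. -/
def edges (G : RawRibbon X) : Finset (Finset X) :=
  (Finset.univ.filter fun x => G.s1 x ≠ x).image
    fun x => ({x, G.th x, G.s1 x, G.s1 (G.th x)} : Finset X)

/-- The flags: pairs `{x, θ x}` of crosses fixed by `σ₁`. -/
def flags (G : RawRibbon X) : Finset (Finset X) :=
  (Finset.univ.filter fun x => G.s1 x = x).image fun x => ({x, G.th x} : Finset X)

/-- The half-ribbons: all pairs `{x, θ x}`. -/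
def halfRibbons (G : RawRibbon X) : Finset (Finset X) :=
  Finset.univ.image fun x => ({x, G.th x} : Finset X)

/-- Orbit of a point under a permutation, as a finset. -/
def permOrbit (f : Equiv.Perm X) (x : X) : Finset X :=
  (Finset.range (Fintype.card X)).image fun n => (f ^ n) x

/-- The vertex containing the cross `x`: the union of the `σ₀`-cycles of `x` and `θ x`. -/
def vertexOf (G : RawRibbon X) (x : X) : Finset X :=
  permOrbit G.s0 x ∪ permOrbit G.s0 (G.th x)

/-- The vertices of the ribbon graph, as finsets of crosses. -/
def vertices (G : RawRibbon X) : Finset (Finset X) :=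
  Finset.univ.image G.vertexOf

/-- `degB G B v` : the number of half-edges incident to `v` that belong to edges of `B`,
plus the number of flags incident to `v`. -/
def degB (G : RawRibbon X) (B : Finset (Finset X)) (v : Finset X) : ℕ :=
  (G.halfRibbons.filter fun h => h ⊆ v ∧ (h ∈ G.flags ∨ ∃ e ∈ B, h ⊆ e)).card

/-- `φ_S` : the permutation agreeing with `f` on `S` and the identity off `S`
(defined whenever `S` is `f`-invariant, and the identity otherwise). -/
def permRestrict (f : Equiv.Perm X) (S : Finset X) : Equiv.Perm X :=
  if h : ∀ x : X, x ∈ S ↔ f x ∈ S then Equiv.Perm.ofSubtype (f.subtypePerm (p := fun x => x ∈ S) fun x => (h x).symm) else 1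

/-- The set of crosses of a set of edges. -/
def crossSet (E' : Finset (Finset X)) : Finset X := E'.biUnion id

/-- Chmutov's partial dual `G^{E'}`. -/
def partialDual (G : RawRibbon X) (E' : Finset (Finset X)) : RawRibbon X where
  s0 := G.s0 * permRestrict G.th (crossSet E') * permRestrict G.s1 (crossSet E')
  th := permRestrict G.s1 (crossSet E') * permRestrict G.th (crossSet E')ᶜ
  s1 := permRestrict G.s1 (crossSet E')ᶜ * permRestrict G.th (crossSet E')

/-- The topological polynomial `Q` of a ribbon graph with flags. -/
def Qpoly {R : Type} [CommRing R] (G : RawRibbon X) (x y z w : Finset X → R) (r : ℕ → R) : R :=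
  ∑ A ∈ G.edges.powerset, ∑ B ∈ (G.partialDual A).edges.powerset,
    (∏ e ∈ (G.edges \ A) ∩ ((G.partialDual A).edges \ B), x e) *
      (∏ e ∈ A ∩ ((G.partialDual A).edges \ B), y e) *
      (∏ e ∈ A ∩ B, z e) *
      (∏ e ∈ (G.edges \ A) ∩ B, w e) *
      ∏ v ∈ (G.partialDual A).vertices, r (degB (G.partialDual A) B v)

/-- The first hyperbolic polynomial `HU` as an evaluation of `Q`. -/
noncomputable def HU (G : RawRibbon X) (Ω t : Finset X → ℝ) : ℝ :=
  Qpoly G t Ω (fun e => Ω e * t e ^ 2) (fun e => t e * Ω e ^ 2)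
    fun n => if Even n then 0 else 2

end RawRibbon

end RibbonPaper

theorem test : True := trivial
namespace RibbonPaper

namespace RawRibbon

variable {X : Type} [Fintype X] [DecidableEq X]

lemma firstRet_exists (f : Equiv.Perm X) (S : Finset X) {x : X} (hx : x ∈ S) :
    ∃ k : ℕ, 0 < k ∧ (f ^ k) x ∈ S :=
  ⟨orderOf f, orderOf_pos f, by rw [pow_orderOf_eq_one]; simpa using hx⟩

open scoped Classical in
/-- The first-return map of a permutation on a subset. -/
noncomputable def firstRet (f : Equiv.Perm X) (S : Finset X) (x : X) : X :=
  if h : ∃ k : ℕ, 0 < k ∧ (f ^ k) x ∈ S then (f ^ Nat.find h) x else x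

lemma firstRet_mem (f : Equiv.Perm X) (S : Finset X) {x : X} (hx : x ∈ S) :
    firstRet f S x ∈ S := by
  rw [firstRet, dif_pos (firstRet_exists f S hx)]
  exact (Nat.find_spec (firstRet_exists f S hx)).2

lemma firstRet_inj_aux (f : Equiv.Perm X) (S : Finset X) {x y : X}
    (hx : x ∈ S) (hy : y ∈ S)
    (hle : Nat.find (firstRet_exists f S hx) ≤ Nat.find (firstRet_exists f S hy))
    (h : firstRet f S x = firstRet f S y) : x = y := by
  have hex := firstRet_exists f S hx
  have hey := firstRet_exists f S hy
  rw [firstRet, dif_pos hex, firstRet, dif_pos hey] at h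
  have hxy : x = (f ^ (Nat.find hey - Nat.find hex)) y := by
    apply Equiv.injective (f ^ Nat.find hex)
    rw [← Equiv.Perm.mul_apply, ← pow_add, Nat.add_sub_cancel' hle]
    exact h
  by_cases h0 : Nat.find hey - Nat.find hex = 0
  · rw [h0, pow_zero] at hxy
    simpa using hxy
  · exfalso
    have hlt : Nat.find hey - Nat.find hex < Nat.find hey :=
      Nat.sub_lt (Nat.find_spec hey).1 (Nat.find_spec hex).1
    apply Nat.find_min hey hlt
    refine ⟨Nat.pos_of_ne_zero h0, ?_⟩
    rw [hxy] at hx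
    exact hx

lemma firstRet_inj (f : Equiv.Perm X) (S : Finset X) {x y : X}
    (hx : x ∈ S) (hy : y ∈ S) (h : firstRet f S x = firstRet f S y) : x = y := by
  rcases le_total (Nat.find (firstRet_exists f S hx)) (Nat.find (firstRet_exists f S hy)) with
    hle | hle
  · exact firstRet_inj_aux f S hx hy hle h
  · exact (firstRet_inj_aux f S hy hx hle h.symm).symm

/-- The permutation induced on a subset `S` by a permutation of `X`
(the first-return map). -/
noncomputable def inducedPerm (f : Equiv.Perm X) (S : Finset X) : Equiv.Perm {x : X // x ∈ S} :=
  Equiv.ofBijective (fun a => ⟨firstRet f S a.1, firstRet_mem f S a.2⟩)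
    (Finite.injective_iff_bijective.mp fun a b hab =>
      Subtype.ext (firstRet_inj f S a.2 b.2 (congrArg Subtype.val hab)))

/-- The ribbon graph obtained by restricting to a subset `S` of the crosses
(deleting all crosses outside `S`). -/
noncomputable def restrict (G : RawRibbon X) (S : Finset X) : RawRibbon {x : X // x ∈ S} :=
  ⟨inducedPerm G.s0 S, inducedPerm G.th S, inducedPerm G.s1 S⟩

/-- Deletion of an edge `e` (given by its finset of crosses). -/
noncomputable def delete (G : RawRibbon X) (e : Finset X) : RawRibbon {x : X // x ∈ eᶜ} :=
  G.restrict eᶜ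

/-- The cut of an edge `e`: `σ₁` is replaced by `(σ₁)_{X∖e}`, so the two
half-edges of `e` become flags. -/
def cut (G : RawRibbon X) (e : Finset X) : RawRibbon X :=
  ⟨G.s0, G.th, permRestrict G.s1 eᶜ⟩

/-- Connectivity: the crosses form a single orbit under the group generated by the
three permutations. -/
def Connected (G : RawRibbon X) : Prop :=
  ∀ x y : X, ∃ g ∈ Subgroup.closure ({G.s0, G.th, G.s1} : Set (Equiv.Perm X)), g x = y

/-- Two vertices are linked by an edge of `A` if `e ∈ A` has a half-edge incident to each. -/
def linked (G : RawRibbon X) (A : Finset (Finset X)) (u v : Finset X) : Prop :=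
  ∃ e ∈ A, (∃ h ∈ G.halfRibbons, h ⊆ e ∧ h ⊆ u) ∧ ∃ h ∈ G.halfRibbons, h ⊆ e ∧ h ⊆ v

/-- Connectivity of two vertices in the spanning subgraph `(V(G), A)`. -/
def vconn (G : RawRibbon X) (A : Finset (Finset X)) : Finset X → Finset X → Prop :=
  Relation.ReflTransGen (G.linked A)

/-- The spanning subgraph `(V(G), A)` is connected. -/
def SpanningConn (G : RawRibbon X) (A : Finset (Finset X)) : Prop :=
  ∀ u ∈ G.vertices, ∀ v ∈ G.vertices, G.vconn A u v

/-- The number of faces (boundary components) of a ribbon graph: the number of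
vertices of its natural dual. -/
def nFaces (G : RawRibbon X) : ℕ := (G.partialDual G.edges).vertices.card

/-- The number of boundary components of the spanning subgraph of `G` with surviving
crosses `S`, counting also the vertices of `G` that have become isolated. -/
noncomputable def nBoundary (G : RawRibbon X) (S : Finset X) : ℕ :=
  (G.restrict S).nFaces + (G.vertices.filter fun v => Disjoint v S).card

/-- A spanning quasi-tree: the spanning subgraph `(V(G), A)` is connected and has
exactly one face. -/
def IsQuasiTree (G : RawRibbon X) (A : Finset (Finset X)) : Prop :=
  G.SpanningConn A ∧ G.nBoundary (crossSet A) = 1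

/-- A spanning tree: the spanning subgraph `(V(G), A)` is connected and
`|A| = v(G) - 1`. -/
def IsSpanningTree (G : RawRibbon X) (A : Finset (Finset X)) : Prop :=
  G.SpanningConn A ∧ A.card + 1 = G.vertices.card

open scoped Classical in
/-- The first Symanzik polynomial of the noncommutative heat-kernel theory. -/
noncomputable def Upoly (G : RawRibbon X) (α : Finset X → ℝ) (θ : ℝ) : ℝ :=
  ∑ A ∈ G.edges.powerset.filter (fun A => G.IsQuasiTree A),
    (θ / 2) ^ (A.card + 1 - G.vertices.card) * ∏ e ∈ G.edges \ A, α e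

end RawRibbon

end RibbonPaper
namespace RibbonPaper

namespace RawRibbon

variable {X : Type} [Fintype X] [DecidableEq X]

/-- Even spanning subgraphs of `G`. -/
def evenSubs (G : RawRibbon X) : Finset (Finset (Finset X)) :=
  G.edges.powerset.filter fun B => ∀ v ∈ G.vertices, Even (G.degB B v)

/-- Odd spanning subgraphs of `G`. -/
def oddSubs (G : RawRibbon X) : Finset (Finset (Finset X)) :=
  G.edges.powerset.filter fun B => ∀ v ∈ G.vertices, Odd (G.degB B v)

/-- Odd cutting spanning subgraphs of `G`: subsets of half-ribbons such that every
vertex is incident to an odd number of them. -/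
def oddCutting (G : RawRibbon X) : Finset (Finset (Finset X)) :=
  G.halfRibbons.powerset.filter fun H =>
    ∀ v ∈ G.vertices, Odd ((H.filter fun h => h ⊆ v).card)

/-- Even cutting spanning subgraphs of `G`. -/
def evenCutting (G : RawRibbon X) : Finset (Finset (Finset X)) :=
  G.halfRibbons.powerset.filter fun H =>
    ∀ v ∈ G.vertices, Even ((H.filter fun h => h ⊆ v).card)

/-- The flag-set of a cutting spanning subgraph `H`: the flags of `G` contained in `H`
together with the edges exactly one of whose two half-edges lies in `H`. -/
def flagSetOf (G : RawRibbon X) (H : Finset (Finset X)) : Finset (Finset X) :=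
  (G.flags ∩ H) ∪ (G.edges.filter fun e => (H.filter fun h => h ⊆ e).card = 1)

/-- Orientability of a ribbon graph with flags. -/
def Orientable (G : RawRibbon X) : Prop :=
  ∃ Xp : Finset X,
    Xp.image G.s0 = Xp ∧ Disjoint Xp (Xp.image G.th) ∧
      Xp ∪ Xp.image G.th = Finset.univ ∧
      ∀ x : X, G.s1 x ≠ x → (x ∈ Xp ↔ G.s1 x ∉ Xp)

/-- The edge variable of the edge of `G` containing the half-ribbon `h`
(as a product over the containing edges; a flag contributes `1`). -/
def halfWeight {R : Type} [CommRing R] (G : RawRibbon X) (t : Finset X → R)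
    (h : Finset X) : R :=
  ∏ e ∈ G.edges.filter (fun e => h ⊆ e), t e

/-- The vertex containing a given half-ribbon. -/
def vertexOfHalf (G : RawRibbon X) (h : Finset X) : Finset X :=
  (G.vertices.filter fun v => h ⊆ v).sup id

/-- The spin product `σ_u σ_{u'}` over the endpoints of an edge `e`, for the spin
configuration assigning `+1` to vertices in `T` and `-1` to the others. -/
noncomputable def spinProd (G : RawRibbon X) (T : Finset (Finset X)) (e : Finset X) : ℝ :=
  ∏ h ∈ G.halfRibbons.filter (fun h => h ⊆ e),
    (if G.vertexOfHalf h ∈ T then (1 : ℝ) else -1)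

/-- An isolated vertex of even degree: incident to no half-edge and to an even
number of flags. -/
def IsIsolatedEvenVertex (G : RawRibbon X) (v : Finset X) : Prop :=
  v ∈ G.vertices ∧ (∀ h ∈ G.halfRibbons, h ⊆ v → h ∈ G.flags) ∧
    Even ((G.flags.filter fun h => h ⊆ v).card)

open scoped Classical in
/-- The number of endpoints of edges of `B` lying in the `A`-connected component of the
vertex `v`, plus the number of flags attached to vertices of that component. -/
noncomputable def compDeg (G : RawRibbon X) (A B : Finset (Finset X)) (v : Finset X) : ℕ :=
  (G.halfRibbons.filter fun h =>
      (h ∈ G.flags ∨ ∃ e ∈ B, h ⊆ e) ∧ ∃ u ∈ G.vertices, G.vconn A v u ∧ h ⊆ u).card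

/-- `(B, V(G/A))` is odd: every connected component of the spanning subgraph
`(V(G), A)` sees an odd number of endpoints of edges of `B` plus flags. -/
def CompOdd (G : RawRibbon X) (A B : Finset (Finset X)) : Prop :=
  ∀ v ∈ G.vertices, Odd (compDeg G A B v)

open scoped Classical in
/-- The connected component of the vertex `v` in the spanning subgraph `(V(G), A)`. -/
noncomputable def compVerts (G : RawRibbon X) (A : Finset (Finset X)) (v : Finset X) :
    Finset (Finset X) :=
  G.vertices.filter fun u => G.vconn A v u

/-- The connected components of the spanning subgraph `(V(G), A)`. -/
noncomputable def components (G : RawRibbon X) (A : Finset (Finset X)) :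
    Finset (Finset (Finset X)) :=
  G.vertices.image fun v => compVerts G A v

/-- The edges of `A` incident to a set of vertices `c`. -/
def compEdges (G : RawRibbon X) (A : Finset (Finset X)) (c : Finset (Finset X)) :
    Finset (Finset X) :=
  A.filter fun e => ∃ h ∈ G.halfRibbons, h ⊆ e ∧ ∃ u ∈ c, h ⊆ u

open scoped Classical in
/-- The cycle edges of a (unicyclic) component `c`: those edges whose removal keeps
the component connected. -/
noncomputable def cycleEdges (G : RawRibbon X) (A : Finset (Finset X))
    (c : Finset (Finset X)) : Finset (Finset X) :=
  (compEdges G A c).filter fun e => ∀ u ∈ c, ∀ u' ∈ c, G.vconn (A.erase e) u u'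

/-- The weight of a connected component in the commutative Mehler-kernel limit. -/
noncomputable def compWeight (G : RawRibbon X) (A : Finset (Finset X)) (Ω t : Finset X → ℝ)
    (c : Finset (Finset X)) : ℝ :=
  if (compEdges G A c).card + 1 = c.card then
    (2 : ℝ) ^ (1 - ((compEdges G A c).card : ℤ)) *
      ∑ e ∈ compEdges G A c,
        Ω e ^ 2 * t e * ∏ e' ∈ (compEdges G A c).erase e, Ω e' * (1 + t e' ^ 2)
  else
    (2 : ℝ) ^ (2 - ((compEdges G A c).card : ℤ)) *
      ∑ C' ∈ (cycleEdges G A c).powerset.filter (fun C' => Odd C'.card),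
        (∏ e ∈ C', Ω e * t e ^ 2) *
          ∏ e' ∈ compEdges G A c \ cycleEdges G A c, Ω e' * (1 + t e' ^ 2)

/-- The graph `Ĝ_{i₀}` : the half-edge `i₀` (with crosses `x₀, θ x₀`) is detached from
its vertex, replaced there by a flag (crosses `inr 0, inr 1`), and attached to a new
bivalent vertex carrying one more flag (crosses `inr 2, inr 3`). -/
def hatGraph (G : RawRibbon X) (x₀ : X) : RawRibbon (X ⊕ Fin 4) where
  s0 :=
    (Equiv.swap (Sum.inl x₀) (Sum.inr 0) * Equiv.swap (Sum.inl (G.th x₀)) (Sum.inr 1)) *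
        Equiv.sumCongr G.s0 (Equiv.refl (Fin 4)) *
        (Equiv.swap (Sum.inl x₀) (Sum.inr 0) * Equiv.swap (Sum.inl (G.th x₀)) (Sum.inr 1))⁻¹ *
      Equiv.swap (Sum.inl x₀) (Sum.inr 2) * Equiv.swap (Sum.inl (G.th x₀)) (Sum.inr 3)
  th := Equiv.sumCongr G.th (Equiv.swap 0 1 * Equiv.swap 2 3)
  s1 := Equiv.sumCongr G.s1 (Equiv.refl (Fin 4))

end RawRibbon

end RibbonPaper
namespace RibbonPaper

namespace RawRibbon

lemma permRestrict_apply_of_inv {X : Type} [Fintype X] [DecidableEq X] (f : Equiv.Perm X)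
    (S : Finset X) (h : ∀ x, x ∈ S → f x ∈ S) (x : X) :
    permRestrict f S x = if x ∈ S then f x else x := by
  have h' : ∀ x : X, x ∈ S ↔ f x ∈ S := by
    intro x
    refine ⟨h x, fun hx => ?_⟩
    have him : S.image f = S := by
      apply Finset.eq_of_subset_of_card_le
      · intro y hy
        obtain ⟨z, hz, rfl⟩ := Finset.mem_image.1 hy
        exact h z hz
      · rw [Finset.card_image_of_injective _ f.injective]
    rw [← him] at hx
    obtain ⟨z, hz, hzx⟩ := Finset.mem_image.1 hx
    rwa [← f.injective hzx]
  rw [permRestrict, dif_pos h']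
  split_ifs with hx
  · rw [Equiv.Perm.ofSubtype_apply_of_mem _ hx]
    rfl
  · exact Equiv.Perm.ofSubtype_apply_of_not_mem _ hx

end RawRibbon

end RibbonPaper

open RibbonPaper RawRibbon in
/-- partial duality is an involution. -/
theorem statement_5 {X : Type} [Fintype X] [DecidableEq X]
    (G : RawRibbon X) (hG : G.IsRibbon) (E' : Finset (Finset X)) (hE : E' ⊆ G.edges) :
    (G.partialDual E').partialDual E' = G := by
  obtain ⟨h1, h2, h3, -⟩ := hG
  have tt : ∀ x, G.th (G.th x) = x := fun x => by
    simpa [pow_two] using congrArg (fun f : Equiv.Perm X => f x) h1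
  have ss : ∀ x, G.s1 (G.s1 x) = x := fun x => by
    simpa [pow_two] using congrArg (fun f : Equiv.Perm X => f x) h2
  have ts : ∀ x, G.th (G.s1 x) = G.s1 (G.th x) := fun x => by
    simpa using congrArg (fun f : Equiv.Perm X => f x) h3
  have inv : ∀ x, x ∈ crossSet E' → G.th x ∈ crossSet E' ∧ G.s1 x ∈ crossSet E' := by
    intro x hx
    simp only [crossSet, Finset.mem_biUnion, id] at hx ⊢
    obtain ⟨e, he, hxe⟩ := hx
    have hee := hE he
    simp only [edges, Finset.mem_image] at hee
    obtain ⟨y, -, rfl⟩ := hee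
    refine ⟨⟨_, he, ?_⟩, ⟨_, he, ?_⟩⟩ <;>
    · simp only [Finset.mem_insert, Finset.mem_singleton] at hxe ⊢
      rcases hxe with rfl | rfl | rfl | rfl <;> simp [tt, ss, ts]
  generalize hS : crossSet E' = S at inv
  have invc : ∀ x, x ∈ Sᶜ → G.th x ∈ Sᶜ ∧ G.s1 x ∈ Sᶜ := by
    intro x hx
    simp only [Finset.mem_compl] at hx ⊢
    exact ⟨fun h => hx (by simpa [tt] using (inv _ h).1),
      fun h => hx (by simpa [ss] using (inv _ h).2)⟩
  have a1 := permRestrict_apply_of_inv G.th S fun x hx => (inv x hx).1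
  have a2 := permRestrict_apply_of_inv G.s1 S fun x hx => (inv x hx).2
  have a3 := permRestrict_apply_of_inv G.th Sᶜ fun x hx => (invc x hx).1
  have a4 := permRestrict_apply_of_inv G.s1 Sᶜ fun x hx => (invc x hx).2
  simp only [Finset.mem_compl] at a3 a4 invc
  have d1 : ∀ x, (G.partialDual E').th x = if x ∈ S then G.s1 x else G.th x := by
    intro x
    simp only [partialDual, hS, Equiv.Perm.mul_apply, a2, a3]
    by_cases hx : x ∈ S
    · simp [hx]
    · simp [hx, (invc x hx).1]
  have d2 : ∀ x, (G.partialDual E').s1 x = if x ∈ S then G.th x else G.s1 x := by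
    intro x
    simp only [partialDual, hS, Equiv.Perm.mul_apply, a1, a4]
    by_cases hx : x ∈ S
    · simp [hx, (inv x hx).1]
    · simp [hx]
  have b1 := permRestrict_apply_of_inv (G.partialDual E').th S
    fun x hx => by rw [d1, if_pos hx]; exact (inv x hx).2
  have b2 := permRestrict_apply_of_inv (G.partialDual E').s1 S
    fun x hx => by rw [d2, if_pos hx]; exact (inv x hx).1
  have b3 := permRestrict_apply_of_inv (G.partialDual E').th Sᶜ
    fun x hx => by
      have := invc x (by simpa using hx)
      rw [d1, if_neg (by simpa using hx)]; simpa using this.1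
  have b4 := permRestrict_apply_of_inv (G.partialDual E').s1 Sᶜ
    fun x hx => by
      have := invc x (by simpa using hx)
      rw [d2, if_neg (by simpa using hx)]; simpa using this.2
  simp only [Finset.mem_compl] at b3 b4
  have e0 : ∀ x, ((G.partialDual E').partialDual E').s0 x = G.s0 x := by
    intro x
    rw [partialDual]
    simp only [hS, Equiv.Perm.mul_apply, b1, b2, d1, d2]
    simp only [partialDual, hS, Equiv.Perm.mul_apply, a1, a2]
    by_cases hx : x ∈ S
    · simp [hx, (inv x hx).1, (inv _ (inv x hx).1).2, ss, tt]
    · simp [hx]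
  have e1 : ∀ x, ((G.partialDual E').partialDual E').th x = G.th x := by
    intro x
    rw [partialDual]
    simp only [hS, Equiv.Perm.mul_apply, b2, b3, d1, d2]
    by_cases hx : x ∈ S
    · simp [hx]
    · simp [hx, (invc x hx).1]
  have e2 : ∀ x, ((G.partialDual E').partialDual E').s1 x = G.s1 x := by
    intro x
    rw [partialDual]
    simp only [hS, Equiv.Perm.mul_apply, b1, b4, d1, d2]
    by_cases hx : x ∈ S
    · simp [hx, (inv x hx).2]
    · simp [hx]
  have f0 := Equiv.ext e0
  have f1 := Equiv.ext e1
  have f2 := Equiv.ext e2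
  generalize (G.partialDual E').partialDual E' = H at f0 f1 f2
  cases H
  cases G
  simp_all
end

section
/- Invariance of the number of colored even spanning subgraphs under single-edge partial duality: for any ribbon graph with flags G and any edge e ∈ E(G), 2^{v(G)} · |Ev(G)| = 2^{v(G^{{e}})} · |Ev(G^{{e}})|, where v denotes the number of vertices and Ev the set of even spanning subgraphs. -/
set_option linter.unusedSectionVars false

open Finset

namespace RibbonPaper
namespace RawRibbon

structure Lite {X : Type} [Fintype X] [DecidableEq X] (G : RawRibbon X) : Prop where
  tt : ∀ x, G.th (G.th x) = x
  ss : ∀ x, G.s1 (G.s1 x) = x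
  ts : ∀ x, G.th (G.s1 x) = G.s1 (G.th x)
  tne : ∀ x, G.th x ≠ x
  tns : ∀ x, G.th x ≠ G.s1 x
  st : ∀ x, G.s0 (G.th (G.s0 x)) = G.th x

variable {X : Type} [Fintype X] [DecidableEq X]

lemma IsRibbon.lite {G : RawRibbon X} (h : G.IsRibbon) : Lite G := by
  obtain ⟨h1, h2, h3, h4, h5, h6, -⟩ := h
  refine ⟨fun x => ?_, fun x => ?_, fun x => ?_, h4, h5, fun x => ?_⟩
  · simpa [pow_two] using congrArg (fun f => f x) h1
  · simpa [pow_two] using congrArg (fun f => f x) h2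
  · simpa using congrArg (fun f => f x) h3
  · simpa using congrArg (fun f => f (G.s0 x)) h6

lemma permRestrict_apply (f : Equiv.Perm X) (S : Finset X) (h : ∀ x, x ∈ S ↔ f x ∈ S) (x : X) :
    permRestrict f S x = if x ∈ S then f x else x := by
  rw [permRestrict, dif_pos h]
  split_ifs with hx
  · rw [Equiv.Perm.ofSubtype_apply_of_mem _ hx]; rfl
  · rw [Equiv.Perm.ofSubtype_apply_of_not_mem _ hx]

lemma edge_closed {G : RawRibbon X} (L : Lite G) {e : Finset X} (he : e ∈ G.edges) :
    (∀ x, x ∈ e ↔ G.th x ∈ e) ∧ (∀ x, x ∈ e ↔ G.s1 x ∈ e) ∧ (∀ x ∈ e, G.s1 x ≠ x) ∧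
    (∀ x ∈ e, e = {x, G.th x, G.s1 x, G.s1 (G.th x)}) := by
  obtain ⟨a, ha, rfl⟩ := Finset.mem_image.1 he
  have ha : G.s1 a ≠ a := by simpa using ha
  have h1 := L.tt; have h2 := L.ss; have h3 := L.ts
  refine ⟨fun x => ?_, fun x => ?_, fun x => ?_, fun x => ?_⟩
  · simp only [Finset.mem_insert, Finset.mem_singleton]; grind
  · simp only [Finset.mem_insert, Finset.mem_singleton]; grind
  · simp only [Finset.mem_insert, Finset.mem_singleton]; grind
  · intro hx
    ext y
    simp only [Finset.mem_insert, Finset.mem_singleton] at hx ⊢; grind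

lemma crossSet_singleton (e : Finset X) : crossSet {e} = e := by simp [crossSet]

section pd

lemma pd_th {G : RawRibbon X} (L : Lite G) {e : Finset X} (he : e ∈ G.edges) (x : X) : (G.partialDual {e}).th x = if x ∈ e then G.s1 x else G.th x := by
  have h1 := (edge_closed L he).1
  have h2 := (edge_closed L he).2.1
  simp only [partialDual, crossSet_singleton, Equiv.Perm.mul_apply]
  rw [permRestrict_apply G.th _ (by simpa using fun x => not_congr (h1 x)),
    permRestrict_apply _ _ h2]
  simp only [Finset.mem_compl]; grind

lemma pd_s1 {G : RawRibbon X} (L : Lite G) {e : Finset X} (he : e ∈ G.edges) (x : X) : (G.partialDual {e}).s1 x = if x ∈ e then G.th x else G.s1 x := by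
  have h1 := (edge_closed L he).1
  have h2 := (edge_closed L he).2.1
  simp only [partialDual, crossSet_singleton, Equiv.Perm.mul_apply]
  rw [permRestrict_apply G.s1 _ (by simpa using fun x => not_congr (h2 x)),
    permRestrict_apply _ _ h1]
  simp only [Finset.mem_compl]; grind

lemma pd_s0 {G : RawRibbon X} (L : Lite G) {e : Finset X} (he : e ∈ G.edges) (x : X) :
    (G.partialDual {e}).s0 x = if x ∈ e then G.s0 (G.th (G.s1 x)) else G.s0 x := by
  have h1 := (edge_closed L he).1
  have h2 := (edge_closed L he).2.1
  simp only [partialDual, crossSet_singleton, Equiv.Perm.mul_apply]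
  rw [permRestrict_apply G.s1 _ h2, permRestrict_apply _ _ h1]
  grind

lemma pd_lite {G : RawRibbon X} (L : Lite G) {e : Finset X} (he : e ∈ G.edges) : Lite (G.partialDual {e}) := by
  obtain ⟨c1, c2, c3, -⟩ := edge_closed L he
  obtain ⟨h1, h2, h3, h4, h5, h6⟩ := L
  have L : Lite G := ⟨h1, h2, h3, h4, h5, h6⟩
  refine ⟨fun x => ?_, fun x => ?_, fun x => ?_, fun x => ?_, fun x => ?_, fun x => ?_⟩ <;>
    simp only [pd_th L he, pd_s1 L he, pd_s0 L he] <;> by_cases hx : x ∈ e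
  all_goals grind

lemma pd_flags {G : RawRibbon X} (L : Lite G) {e : Finset X} (he : e ∈ G.edges) : (G.partialDual {e}).flags = G.flags := by
  obtain ⟨c1, c2, c3, -⟩ := edge_closed L he
  have h4 := L.tne
  unfold flags
  have : (Finset.univ.filter fun x => (G.partialDual {e}).s1 x = x) =
      Finset.univ.filter fun x => G.s1 x = x := by
    ext x
    simp only [Finset.mem_filter, pd_s1 L he, Finset.mem_univ, true_and]
    grind
  rw [this]
  apply Finset.image_congr
  intro x hx
  have hx : G.s1 x = x := by simpa using hx
  have : x ∉ e := fun h => c3 x h hx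
  simp [pd_th L he, this]

lemma pd_edges {G : RawRibbon X} (L : Lite G) {e : Finset X} (he : e ∈ G.edges) : (G.partialDual {e}).edges = G.edges := by
  obtain ⟨c1, c2, c3, -⟩ := edge_closed L he
  have h4 := L.tne
  unfold edges
  have : (Finset.univ.filter fun x => (G.partialDual {e}).s1 x ≠ x) =
      Finset.univ.filter fun x => G.s1 x ≠ x := by
    ext x
    simp only [Finset.mem_filter, pd_s1 L he, Finset.mem_univ, true_and]
    grind
  rw [this]
  apply Finset.image_congr
  intro x hx
  have h3 := L.ts x
  by_cases h : x ∈ e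
  · have := (c2 x).1 h
    ext y
    simp only [pd_th L he, pd_s1 L he, h, this, if_true, Finset.mem_insert, Finset.mem_singleton]
    grind
  · have : G.th x ∉ e := fun h' => h ((c1 x).2 h')
    simp [pd_th L he, pd_s1 L he, h, this]
end pd

/-- Subsets closed under all three permutations. -/
def Closed (G : RawRibbon X) (U : Finset X) : Prop :=
  (∀ x, x ∈ U ↔ G.s0 x ∈ U) ∧ (∀ x, x ∈ U ↔ G.th x ∈ U) ∧ (∀ x, x ∈ U ↔ G.s1 x ∈ U)

lemma pd_closed {G : RawRibbon X} (L : Lite G) {e : Finset X} (he : e ∈ G.edges) (U : Finset X) :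
    Closed (G.partialDual {e}) U ↔ Closed G U := by
  unfold Closed
  simp only [pd_th L he, pd_s1 L he, pd_s0 L he]
  constructor
  · rintro ⟨a, b, c⟩
    have hs : ∀ x, x ∈ U ↔ G.s1 x ∈ U := fun x => by grind
    have ht : ∀ x, x ∈ U ↔ G.th x ∈ U := fun x => by grind
    refine ⟨fun x => ?_, ht, hs⟩
    by_cases h : x ∈ e
    · obtain ⟨c1, c2, c3, -⟩ := edge_closed L he
      have e1 : G.th (G.s1 x) ∈ e := (c1 _).1 ((c2 _).1 h)
      have h1 := a (G.th (G.s1 x))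
      rw [if_pos e1] at h1
      rw [← L.ts, L.tt, L.ss] at h1
      rw [← h1, ← ht, ← hs]
    · have := a x
      rwa [if_neg h] at this
  · rintro ⟨a, b, c⟩
    refine ⟨fun x => ?_, fun x => ?_, fun x => ?_⟩ <;> split_ifs
    · rw [← a, ← b, ← c]
    · exact a x
    · exact c x
    · exact b x
    · exact b x
    · exact c x

/-! vertices -/

lemma mem_permOrbit (f : Equiv.Perm X) (x y : X) : y ∈ permOrbit f x ↔ f.SameCycle x y := by
  unfold permOrbit
  simp only [Finset.mem_image, Finset.mem_range]
  constructor
  · rintro ⟨n, -, rfl⟩; exact ⟨n, by simp⟩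
  · intro h
    by_cases hx : f x = x
    · refine ⟨0, Fintype.card_pos_iff.2 ⟨x⟩, ?_⟩
      simpa using h.eq_of_left hx
    · obtain ⟨i, hi, h⟩ := h.exists_pow_eq_of_mem_support (by simpa using hx)
      exact ⟨i, lt_of_lt_of_le hi (Finset.card_le_univ _), h⟩

lemma th_same {G : RawRibbon X} (L : Lite G) {x y : X} (h : G.s0.SameCycle x y) :
    G.s0.SameCycle (G.th x) (G.th y) := by
  obtain ⟨n, hn, rfl⟩ : ∃ n, n < Fintype.card X ∧ (G.s0 ^ n) x = y := by
    have := (mem_permOrbit G.s0 x y).2 h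
    simpa [permOrbit] using this
  clear h hn
  induction n with
  | zero => exact Equiv.Perm.SameCycle.refl _ _
  | succ n ih =>
    refine ih.trans ?_
    rw [pow_succ', Equiv.Perm.mul_apply]
    have := L.st ((G.s0 ^ n) x)
    refine Equiv.Perm.SameCycle.symm ⟨1, by simpa using this⟩

lemma mem_vertexOf (G : RawRibbon X) (x y : X) :
    y ∈ G.vertexOf x ↔ G.s0.SameCycle x y ∨ G.s0.SameCycle (G.th x) y := by
  simp [vertexOf, mem_permOrbit]

lemma self_mem_vertexOf (G : RawRibbon X) (x : X) : x ∈ G.vertexOf x := by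
  rw [mem_vertexOf]; exact Or.inl (Equiv.Perm.SameCycle.refl _ _)

lemma vertexOf_eq {G : RawRibbon X} (L : Lite G) {x y : X} (h : y ∈ G.vertexOf x) :
    G.vertexOf y = G.vertexOf x := by
  rw [mem_vertexOf] at h
  ext z
  simp only [mem_vertexOf]
  rcases h with h | h
  · have h' := th_same L h
    exact or_congr ⟨h.trans, h.symm.trans⟩ ⟨h'.trans, h'.symm.trans⟩
  · have h' := th_same L h
    rw [L.tt] at h'
    rw [or_comm]
    exact or_congr ⟨h'.trans, h'.symm.trans⟩ ⟨h.trans, h.symm.trans⟩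

/-- closed under s0 and th -/
def VClosed (G : RawRibbon X) (U : Finset X) : Prop :=
  (∀ x, x ∈ U ↔ G.s0 x ∈ U) ∧ (∀ x, x ∈ U ↔ G.th x ∈ U)

lemma vclosed_sub {G : RawRibbon X} {U : Finset X} (h : VClosed G U) {x : X}
    (hx : x ∈ U) : G.vertexOf x ⊆ U := by
  have key : ∀ x ∈ U, permOrbit G.s0 x ⊆ U := by
    intro x hx y hy
    simp only [permOrbit, Finset.mem_image] at hy
    obtain ⟨n, -, rfl⟩ := hy
    induction n with
    | zero => simpa
    | succ n ih => rw [pow_succ', Equiv.Perm.mul_apply]; exact (h.1 _).1 ih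
  exact Finset.union_subset (key x hx) (key _ ((h.2 x).1 hx))

lemma vertex_eq {G : RawRibbon X} (L : Lite G) {v : Finset X} (hv : v ∈ G.vertices) {x : X}
    (h : x ∈ v) : v = G.vertexOf x := by
  obtain ⟨y, -, rfl⟩ := Finset.mem_image.1 hv
  exact (vertexOf_eq L h).symm

lemma vertex_vclosed {G : RawRibbon X} (L : Lite G) {v : Finset X} (hv : v ∈ G.vertices) :
    VClosed G v := by
  have t1 : ∀ x, G.s0 x ∈ G.vertexOf x := fun x => by
    rw [mem_vertexOf]; left; exact ⟨1, by simp⟩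
  have t2 : ∀ x, G.th x ∈ G.vertexOf x := fun x => by
    rw [mem_vertexOf]; right; rfl
  obtain ⟨y, -, rfl⟩ := Finset.mem_image.1 hv
  have key : ∀ x z, z ∈ G.vertexOf x → (x ∈ G.vertexOf y ↔ z ∈ G.vertexOf y) := by
    intro x z hz
    constructor
    · intro h; rw [← vertexOf_eq L h]; exact hz
    · intro h; rw [← vertexOf_eq L h, vertexOf_eq L hz]; exact self_mem_vertexOf G x
  exact ⟨fun x => key _ _ (t1 x), fun x => key _ _ (t2 x)⟩

lemma half_nonempty {G : RawRibbon X} {h : Finset X} (hh : h ∈ G.halfRibbons) :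
    ∃ x, h = {x, G.th x} := by
  obtain ⟨y, -, rfl⟩ := Finset.mem_image.1 hh
  exact ⟨y, rfl⟩

lemma half_sub {G : RawRibbon X} {U : Finset X} (hU : ∀ x, x ∈ U ↔ G.th x ∈ U) (x : X) :
    ({x, G.th x} : Finset X) ⊆ U ↔ x ∈ U := by
  simp [Finset.insert_subset_iff, ← hU]

lemma deg_union {G : RawRibbon X} (L : Lite G) (B T : Finset (Finset X)) (hT : T ⊆ G.vertices) :
    G.degB B (T.biUnion id) = ∑ v ∈ T, G.degB B v := by
  unfold degB
  rw [← Finset.card_biUnion]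
  · congr 1
    ext h
    simp only [Finset.mem_filter, Finset.mem_biUnion]
    constructor
    · rintro ⟨hh, hs, hp⟩
      obtain ⟨x, rfl⟩ := half_nonempty hh
      have : x ∈ T.biUnion id := hs (by simp)
      obtain ⟨v, hv, hx⟩ := Finset.mem_biUnion.1 this
      exact ⟨v, hv, hh, (half_sub (vertex_vclosed L (hT hv)).2 x).2 hx, hp⟩
    · rintro ⟨v, hv, hh, hs, hp⟩
      exact ⟨hh, hs.trans (Finset.subset_biUnion_of_mem id hv), hp⟩
  · intro v hv w hw hne
    rw [Function.onFun, Finset.disjoint_left]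
    intro h h1 h2
    simp only [Finset.mem_filter] at h1 h2
    obtain ⟨x, rfl⟩ := half_nonempty h1.1
    have a : x ∈ v := h1.2.1 (by simp)
    have b : x ∈ w := h2.2.1 (by simp)
    exact hne ((vertex_eq L (hT hv) a).trans (vertex_eq L (hT hw) b).symm)

lemma deg_split {G : RawRibbon X} (L : Lite G) (B : Finset (Finset X)) (hB : B ⊆ G.edges)
    (U : Finset X) :
    G.degB B U = (G.flags.filter (· ⊆ U)).card +
      ∑ e ∈ B, (G.halfRibbons.filter fun h => h ⊆ e ∧ h ⊆ U).card := by
  unfold degB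
  rw [← Finset.card_biUnion, ← Finset.card_union_of_disjoint]
  · congr 1
    ext h
    simp only [Finset.mem_filter, Finset.mem_biUnion, Finset.mem_union]
    have : h ∈ G.flags → h ∈ G.halfRibbons := by
      intro hf
      obtain ⟨y, -, rfl⟩ := Finset.mem_image.1 hf
      exact Finset.mem_image_of_mem _ (Finset.mem_univ y)
    grind
  · rw [Finset.disjoint_left]
    intro h h1 h2
    simp only [Finset.mem_filter, Finset.mem_biUnion] at h1 h2
    obtain ⟨y, hy, rfl⟩ := Finset.mem_image.1 h1.1
    obtain ⟨e, he, -, hs, -⟩ := h2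
    exact (edge_closed L (hB he)).2.2.1 y (hs (by simp)) (by simpa using hy)
  · intro v hv w hw hne
    rw [Function.onFun, Finset.disjoint_left]
    intro h h1 h2
    simp only [Finset.mem_filter] at h1 h2
    obtain ⟨x, rfl⟩ := half_nonempty h1.1
    have a : x ∈ v := h1.2.1 (by simp)
    have b : x ∈ w := h2.2.1 (by simp)
    exact hne (((edge_closed L (hB hv)).2.2.2 x a).trans ((edge_closed L (hB hw)).2.2.2 x b).symm)

open scoped Classical in
lemma edge_factor {G : RawRibbon X} (L : Lite G) {e : Finset X} (he : e ∈ G.edges)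
    {U : Finset X} (hU : ∀ x, x ∈ U ↔ G.th x ∈ U) :
    (1 : ℤ) + (-1) ^ (G.halfRibbons.filter fun h => h ⊆ e ∧ h ⊆ U).card =
      if (∀ x ∈ e, x ∈ U ↔ G.s1 x ∈ U) then 2 else 0 := by
  obtain ⟨c1, c2, c3, c4⟩ := edge_closed L he
  obtain ⟨a, ha, hae⟩ := Finset.mem_image.1 he
  have hae' : a ∈ e := by rw [← hae]; simp
  have hsa : G.s1 a ∈ e := (c2 a).1 hae'
  have key : (G.halfRibbons.filter fun h => h ⊆ e ∧ h ⊆ U) =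
      (({a, G.s1 a} : Finset X).filter (· ∈ U)).image fun x => {x, G.th x} := by
    ext h
    simp only [Finset.mem_filter, Finset.mem_image]
    constructor
    · rintro ⟨hh, h1, h2⟩
      obtain ⟨x, rfl⟩ := half_nonempty hh
      rw [half_sub hU] at h2
      rw [half_sub c1] at h1
      rw [← hae] at h1
      have tt := L.tt
      have ts := L.ts
      simp only [Finset.mem_insert, Finset.mem_singleton] at h1 ⊢
      have hc : ∀ z : X, ({G.th z, G.th (G.th z)} : Finset X) = {z, G.th z} := by
        intro z; rw [tt, Finset.pair_comm]
      rcases h1 with rfl | rfl | rfl | rfl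
      · exact ⟨_, ⟨Or.inl rfl, h2⟩, rfl⟩
      · exact ⟨a, ⟨Or.inl rfl, (hU _).2 h2⟩, (hc _).symm⟩
      · exact ⟨_, ⟨Or.inr rfl, h2⟩, rfl⟩
      · rw [← ts] at h2 ⊢
        exact ⟨_, ⟨Or.inr rfl, (hU _).2 h2⟩, (hc _).symm⟩
    · rintro ⟨x, ⟨h1, h2⟩, rfl⟩
      refine ⟨Finset.mem_image_of_mem _ (Finset.mem_univ x), (half_sub c1 x).2 ?_,
        (half_sub hU x).2 h2⟩
      simp only [Finset.mem_insert, Finset.mem_singleton] at h1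
      rcases h1 with rfl | rfl <;> assumption
  have hinj : Set.InjOn (fun x => ({x, G.th x} : Finset X))
      (({a, G.s1 a} : Finset X).filter (· ∈ U) : Finset X) := by
    intro x hx y hy hxy
    simp only [Finset.coe_filter, Finset.mem_insert, Finset.mem_singleton, Set.mem_ofPred_eq] at hx hy
    have : x ∈ ({y, G.th y} : Finset X) := by
      have hxy' : ({x, G.th x} : Finset X) = {y, G.th y} := hxy
      rw [← hxy']; simp
    simp only [Finset.mem_insert, Finset.mem_singleton] at this
    have := L.tns; have := L.ss; have := L.tne
    grind
  have hne : a ≠ G.s1 a := (c3 a hae').symm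
  rw [key, Finset.card_image_of_injOn hinj]
  have hiff : (∀ x ∈ e, x ∈ U ↔ G.s1 x ∈ U) ↔ (a ∈ U ↔ G.s1 a ∈ U) := by
    refine ⟨fun h => h a hae', fun h x hx => ?_⟩
    rw [← hae] at hx
    simp only [Finset.mem_insert, Finset.mem_singleton] at hx
    rcases hx with rfl | rfl | rfl | rfl
    · exact h
    · rw [← hU, ← L.ts, ← hU]; exact h
    · rw [L.ss]; exact h.symm
    · rw [L.ss, ← L.ts, ← hU, ← hU]; exact h.symm
  simp only [hiff]
  by_cases p : a ∈ U <;> by_cases q : G.s1 a ∈ U <;>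
    simp [Finset.filter_insert, Finset.filter_singleton, p, q, hne]

open scoped Classical in
lemma count {G : RawRibbon X} (L : Lite G) :
    ((2 ^ G.vertices.card * (evenSubs G).card : ℕ) : ℤ) =
      2 ^ G.edges.card *
        ∑ U ∈ Finset.univ.filter (Closed G), (-1) ^ (G.flags.filter (· ⊆ U)).card := by
  have s1 : ((2 ^ G.vertices.card * (evenSubs G).card : ℕ) : ℤ) =
      ∑ B ∈ G.edges.powerset, ∏ v ∈ G.vertices, (1 + (-1 : ℤ) ^ G.degB B v) := by
    rw [evenSubs, Finset.card_filter]
    push_cast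
    rw [Finset.mul_sum]
    refine Finset.sum_congr rfl fun B hB => ?_
    by_cases h : ∀ v ∈ G.vertices, Even (G.degB B v)
    · rw [if_pos h, Finset.prod_congr rfl (g := fun _ => (2 : ℤ))]
      · simp
      · intro v hv; rw [(h v hv).neg_one_pow]; norm_num
    · rw [if_neg h, mul_zero]
      push Not at h
      obtain ⟨v, hv, h⟩ := h
      symm
      refine Finset.prod_eq_zero hv ?_
      rw [(Nat.not_even_iff_odd.1 h).neg_one_pow]; norm_num
  have s2 : ∀ B ∈ G.edges.powerset, ∏ v ∈ G.vertices, (1 + (-1 : ℤ) ^ G.degB B v) =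
      ∑ U ∈ Finset.univ.filter (VClosed G), (-1) ^ G.degB B U := by
    intro B hB
    rw [Finset.prod_one_add]
    refine Finset.sum_nbij' (fun T => T.biUnion id) (fun U => G.vertices.filter (· ⊆ U))
      ?_ ?_ ?_ ?_ ?_
    · intro T hT
      have hT := Finset.mem_powerset.1 hT
      simp only [Finset.mem_filter, Finset.mem_univ, true_and]
      constructor <;> intro x <;> simp only [Finset.mem_biUnion, id] <;>
        refine exists_congr fun v => and_congr_right fun hv => ?_
      · exact (vertex_vclosed L (hT hv)).1 x
      · exact (vertex_vclosed L (hT hv)).2 x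
    · intro U hU
      simp
    · intro T hT
      have hT := Finset.mem_powerset.1 hT
      ext v
      simp only [Finset.mem_filter]
      constructor
      · rintro ⟨hv, hs⟩
        obtain ⟨x, -, rfl⟩ := Finset.mem_image.1 hv
        have hx := hs (self_mem_vertexOf G x)
        obtain ⟨w, hw, hx⟩ := Finset.mem_biUnion.1 hx
        rw [← vertex_eq L (hT hw) hx]; exact hw
      · intro hv
        exact ⟨hT hv, Finset.subset_biUnion_of_mem id hv⟩
    · intro U hU
      simp only [Finset.mem_filter, Finset.mem_univ, true_and] at hU
      ext x
      simp only [Finset.mem_biUnion, Finset.mem_filter, id]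
      constructor
      · rintro ⟨v, ⟨-, h⟩, hx⟩; exact h hx
      · intro hx
        exact ⟨G.vertexOf x, ⟨Finset.mem_image_of_mem _ (Finset.mem_univ x), vclosed_sub hU hx⟩,
          self_mem_vertexOf G x⟩
    · intro T hT
      rw [deg_union L B T (Finset.mem_powerset.1 hT), Finset.prod_pow_eq_pow_sum]
  rw [s1, Finset.sum_congr rfl s2, Finset.sum_comm]
  have s3 : ∀ U ∈ Finset.univ.filter (VClosed G),
      ∑ B ∈ G.edges.powerset, (-1 : ℤ) ^ G.degB B U =
      if Closed G U then 2 ^ G.edges.card * (-1) ^ (G.flags.filter (· ⊆ U)).card else 0 := by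
    intro U hU
    simp only [Finset.mem_filter, Finset.mem_univ, true_and] at hU
    have : ∀ B ∈ G.edges.powerset, (-1 : ℤ) ^ G.degB B U =
        (-1) ^ (G.flags.filter (· ⊆ U)).card *
        ∏ e ∈ B, (-1) ^ (G.halfRibbons.filter fun h => h ⊆ e ∧ h ⊆ U).card := by
      intro B hB
      rw [deg_split L B (Finset.mem_powerset.1 hB), pow_add, Finset.prod_pow_eq_pow_sum]
    rw [Finset.sum_congr rfl this, ← Finset.mul_sum, ← Finset.prod_one_add,
      Finset.prod_congr rfl fun e he => edge_factor L he hU.2]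
    split_ifs with hc
    · rw [Finset.prod_congr rfl (g := fun _ => (2 : ℤ))]
      · simp [mul_comm]
      · intro e he
        rw [if_pos fun x _ => hc.2.2 x]
    · have : ∃ x, ¬ (x ∈ U ↔ G.s1 x ∈ U) := by
        by_contra! hcon
        exact hc ⟨hU.1, hU.2, hcon⟩
      obtain ⟨x, hx⟩ := this
      have hx' : G.s1 x ≠ x := fun h => hx (by rw [h])
      rw [Finset.prod_eq_zero (i := ({x, G.th x, G.s1 x, G.s1 (G.th x)} : Finset X)), mul_zero]
      · exact Finset.mem_image.2 ⟨x, by simpa using hx', rfl⟩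
      · rw [if_neg]
        intro h
        exact hx (h x (by simp))
  rw [Finset.sum_congr rfl s3, ← Finset.sum_filter, Finset.filter_filter, Finset.mul_sum]
  refine Finset.sum_congr ?_ fun _ _ => rfl
  ext U
  simp only [Finset.mem_filter, Finset.mem_univ, true_and]
  exact ⟨fun h => h.2, fun h => ⟨⟨h.1, h.2.1⟩, h⟩⟩

end RawRibbon
end RibbonPaper
open RibbonPaper RawRibbon in
/-- invariance of the number of colored even spanning subgraphs under
single-edge partial duality. -/
theorem statement_7 {X : Type} [Fintype X] [DecidableEq X]
    (G : RawRibbon X) (hG : G.IsRibbon) (e : Finset X) (he : e ∈ G.edges) :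
    2 ^ G.vertices.card * (evenSubs G).card =
      2 ^ (G.partialDual {e}).vertices.card * (evenSubs (G.partialDual {e})).card := by
  have L := IsRibbon.lite hG
  have h1 := count L
  have h2 := count (pd_lite L he)
  rw [pd_edges L he, pd_flags L he] at h2
  have hc : Closed (G.partialDual {e}) = Closed G := funext fun U => propext (pd_closed L he U)
  rw [hc] at h2
  exact_mod_cast h1.trans h2.symm
end
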